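/- Suppose that S^r = Σ_{i=1}^{r} [κ_{i−1}(u_i−u_{i−1}) + d_i] < 0 for some r with 1 ≤ r ≤ n, or that S_r = Σ_{i=r}^{n} [κ_i(u_{i+1}−u_i) + d_i] < 0 for some r with 1 ≤ r ≤ n. Then E is unbounded below on Ω (inf_{ξ̄ ∈ Ω} E(ξ̄) = −∞); in particular, for every c ∈ ℝ the sub-level set Ω_c = {ξ̄ ∈ Ω : E(ξ̄) ≤ c} is unbounded. -/

import Mathlib

open Real Filter Finset

/-- The rescaled Gaussian cumulative distribution function
`F(ξ) = (1/(2√π)) ∫_{-∞}^{ξ} e^{-s²/4} ds`. -/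
noncomputable def F (x : ℝ) : ℝ :=
  (1 / (2 * Real.sqrt Real.pi)) * ∫ s in Set.Iio x, Real.exp (-s ^ 2 / 4)

/-- The derivative `F'(ξ) = (1/(2√π)) e^{-ξ²/4}`. -/
noncomputable def F' (x : ℝ) : ℝ :=
  (1 / (2 * Real.sqrt Real.pi)) * Real.exp (-x ^ 2 / 4)

/-- The functional
`E(ξ̄) = −Σ_{i=0}^{n} k_i(u_{i+1}−u_i) ln(F(ξ_{i+1}/a_i) − F(ξ_i/a_i)) + Σ_{i=1}^{n} d_i ξ_i²/4`,
with the conventions `ξ₀ = −∞`, `ξ_{n+1} = +∞`, i.e. `F(ξ₀/a₀) = 0`, `F(ξ_{n+1}/a_n) = 1`.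
Here `ξ : ℕ → ℝ`, only the values `ξ 1, …, ξ n` being relevant. -/
noncomputable def E (n : ℕ) (u a k d : ℕ → ℝ) (ξ : ℕ → ℝ) : ℝ :=
  -(∑ i ∈ Finset.range (n + 1), k i * (u (i + 1) - u i) *
      Real.log ((if i = n then 1 else F (ξ (i + 1) / a i)) -
        (if i = 0 then 0 else F (ξ i / a i))))
  + ∑ i ∈ Finset.Icc 1 n, d i * ξ i ^ 2 / 4

/-- Reindexing of a point of `ℝⁿ` as the sequence `ξ_1, …, ξ_n` (paper indexing). -/
noncomputable def toSeq (n : ℕ) (x : EuclideanSpace ℝ (Fin n)) : ℕ → ℝ :=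
  fun i => if h : i - 1 < n then x ⟨i - 1, h⟩ else 0

/-- The left-hand side of the `i`-th equation (`1 ≤ i ≤ n`) of the Stefan system:
`d_i ξ_i/2 + k_i(u_{i+1}−u_i) F'(ξ_i/a_i)/(a_i (F(ξ_{i+1}/a_i) − F(ξ_i/a_i)))
 − k_{i−1}(u_i−u_{i−1}) F'(ξ_i/a_{i−1})/(a_{i−1} (F(ξ_i/a_{i−1}) − F(ξ_{i−1}/a_{i−1})))`,
with the conventions `ξ₀ = −∞` (so `F(ξ₀/a₀) = 0`) and `ξ_{n+1} = +∞` (so `F(ξ_{n+1}/a_n) = 1`). -/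
noncomputable def stefanLHS (n : ℕ) (u a k d : ℕ → ℝ) (ξ : ℕ → ℝ) (i : ℕ) : ℝ :=
  d i * ξ i / 2
  + k i * (u (i + 1) - u i) * F' (ξ i / a i) /
      (a i * ((if i = n then 1 else F (ξ (i + 1) / a i)) - F (ξ i / a i)))
  - k (i - 1) * (u i - u (i - 1)) * F' (ξ i / a (i - 1)) /
      (a (i - 1) * (F (ξ i / a (i - 1)) - (if i = 1 then 0 else F (ξ (i - 1) / a (i - 1)))))

/-- The Gaussian weight `e^{-s²/4}` is integrable. -/
theorem integrable_exp_neg_sq_div_four :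
    MeasureTheory.Integrable (fun s : ℝ => Real.exp (-s ^ 2 / 4)) := by
  refine (integrable_exp_neg_mul_sq (b := 1 / 4) (by norm_num)).congr (.of_forall fun s => ?_)
  ring_nf

theorem F_nonneg (x : ℝ) : 0 ≤ F x :=
  mul_nonneg (by positivity) (MeasureTheory.integral_nonneg fun _ => (Real.exp_pos _).le)

theorem F_le_one (x : ℝ) : F x ≤ 1 := by
  have h : ∫ s : ℝ, Real.exp (-s ^ 2 / 4) = 2 * √π := by
    have := integral_gaussian (1 / 4)
    rw [show π / (1 / 4) = 2 ^ 2 * π by ring, Real.sqrt_mul (by norm_num),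
      Real.sqrt_sq (by norm_num)] at this
    rw [← this]
    congr 1 with s
    ring_nf
  have hle : ∫ s in Set.Iio x, Real.exp (-s ^ 2 / 4) ≤ 2 * √π := by
    rw [← h]
    exact MeasureTheory.setIntegral_le_integral integrable_exp_neg_sq_div_four
      (.of_forall fun _ => (Real.exp_pos _).le)
  have hpos : 0 < 2 * √π := by positivity
  rw [F, one_div, inv_mul_le_iff₀ hpos, mul_one]
  exact hle

theorem F_sub_F (x y : ℝ) :
    F y - F x = 1 / (2 * √π) * ∫ s in x..y, Real.exp (-s ^ 2 / 4) := by
  rw [F, F, ← mul_sub, ← MeasureTheory.integral_Iic_eq_integral_Iio,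
    ← MeasureTheory.integral_Iic_eq_integral_Iio,
    intervalIntegral.integral_Iic_sub_Iic integrable_exp_neg_sq_div_four.integrableOn
      integrable_exp_neg_sq_div_four.integrableOn]

theorem F_mono : Monotone F := fun x y hxy => by
  rw [← sub_nonneg, F_sub_F]
  exact mul_nonneg (by positivity)
    (intervalIntegral.integral_nonneg hxy fun _ _ => (Real.exp_pos _).le)

/-- A lower bound for the Gaussian mass of a scaled unit interval. -/
theorem exp_le_F_sub_F {a : ℝ} (ha : 0 < a) (y : ℝ) {M : ℝ} (hM : |y| + 1 ≤ M) :
    1 / (2 * √π * a) * Real.exp (-(M ^ 2 / (4 * a ^ 2))) ≤ F ((y + 1) / a) - F (y / a) := by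
  have hle : y / a ≤ (y + 1) / a := by gcongr; linarith
  have hint : ∫ _ in (y / a)..((y + 1) / a), Real.exp (-(M ^ 2 / (4 * a ^ 2))) ≤
      ∫ s in (y / a)..((y + 1) / a), Real.exp (-s ^ 2 / 4) := by
    refine intervalIntegral.integral_mono_on hle intervalIntegrable_const
      integrable_exp_neg_sq_div_four.intervalIntegrable fun s hs => ?_
    have h1 : y ≤ s * a := (div_le_iff₀ ha).1 hs.1
    have h2 : s * a ≤ y + 1 := (le_div_iff₀ ha).1 hs.2
    have h3 : (s * a) ^ 2 ≤ M ^ 2 :=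
      sq_le_sq' (by linarith [neg_abs_le y]) (by linarith [le_abs_self y])
    rw [Real.exp_le_exp, neg_div, neg_le_neg_iff, div_le_div_iff₀ (by norm_num) (by positivity)]
    nlinarith
  rw [intervalIntegral.integral_const, smul_eq_mul] at hint
  rw [F_sub_F]
  calc _ = 1 / (2 * √π) * (((y + 1) / a - y / a) * Real.exp (-(M ^ 2 / (4 * a ^ 2)))) := by
        field_simp
        ring
    _ ≤ _ := by gcongr

/-- The logarithmic term of `E` grows at most quadratically. -/
theorem neg_log_le_of_F_sub_F_le {a : ℝ} (ha : 0 < a) {y M D : ℝ} (hM : |y| + 1 ≤ M)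
    (hD : F ((y + 1) / a) - F (y / a) ≤ D) :
    -Real.log D ≤ M ^ 2 / (4 * a ^ 2) + Real.log (2 * √π * a) := by
  have hpos : 0 < 2 * √π * a := by positivity
  have h := Real.log_le_log (by positivity) ((exp_le_F_sub_F ha y hM).trans hD)
  rw [Real.log_mul (by positivity) (Real.exp_pos _).ne', Real.log_exp, one_div,
    Real.log_inv] at h
  linarith

/-- Along the ray `ξ_i = i + s_i R`, the functional `E` is bounded above by a quadratic polynomial
in `R` with explicit leading coefficient. -/
theorem exists_E_ray_le (n : ℕ) (u a k d s t : ℕ → ℝ)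
    (hu : ∀ i ≤ n, u i < u (i + 1)) (ha : ∀ i ≤ n, 0 < a i) (hk : ∀ i ≤ n, 0 < k i)
    (hst : ∀ i, s i ≤ t i) (hts : ∀ i, t i ≤ s (i + 1)) :
    ∃ b c : ℝ, ∀ R, 0 ≤ R → ∀ ξ : ℕ → ℝ, (∀ i, 1 ≤ i → i ≤ n → ξ i = i + s i * R) →
      E n u a k d ξ ≤ (∑ i ∈ Finset.range (n + 1), k i / a i ^ 2 * (u (i + 1) - u i) * t i ^ 2 +
        ∑ i ∈ Finset.Icc 1 n, d i * s i ^ 2) * (R ^ 2 / 4) + b * R + c := by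
  refine ⟨∑ i ∈ Finset.range (n + 1),
      k i * (u (i + 1) - u i) * ((i + 1) * |t i| / (2 * a i ^ 2)) +
      ∑ i ∈ Finset.Icc 1 n, d i * i * s i / 2,
    ∑ i ∈ Finset.range (n + 1),
      k i * (u (i + 1) - u i) * ((i + 1) ^ 2 / (4 * a i ^ 2) + Real.log (2 * √π * a i)) +
      ∑ i ∈ Finset.Icc 1 n, d i * i ^ 2 / 4, fun R hR ξ hξ => ?_⟩
  have hlog : ∀ i ∈ Finset.range (n + 1),
      -(k i * (u (i + 1) - u i) * Real.log ((if i = n then 1 else F (ξ (i + 1) / a i)) -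
        (if i = 0 then 0 else F (ξ i / a i)))) ≤
      k i / a i ^ 2 * (u (i + 1) - u i) * t i ^ 2 * (R ^ 2 / 4) +
        k i * (u (i + 1) - u i) * ((i + 1) * |t i| / (2 * a i ^ 2)) * R +
        k i * (u (i + 1) - u i) * ((i + 1) ^ 2 / (4 * a i ^ 2) + Real.log (2 * √π * a i)) := by
    intro i hi
    have hin : i ≤ n := Nat.lt_succ_iff.1 (Finset.mem_range.1 hi)
    have hai := ha i hin
    have hw : 0 ≤ k i * (u (i + 1) - u i) :=
      mul_nonneg (hk i hin).le (sub_nonneg.2 (hu i hin).le)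
    have hM : |(i : ℝ) + t i * R| + 1 ≤ i + 1 + |t i| * R := by
      have h := abs_add_le (i : ℝ) (t i * R)
      rw [abs_mul, abs_of_nonneg hR, Nat.abs_cast] at h
      linarith
    have hupper : F ((i + t i * R + 1) / a i) ≤ if i = n then 1 else F (ξ (i + 1) / a i) := by
      split_ifs with h
      · exact F_le_one _
      · refine F_mono (div_le_div_of_nonneg_right ?_ hai.le)
        rw [hξ (i + 1) (by omega) (by omega)]
        push_cast
        linarith [mul_le_mul_of_nonneg_right (hts i) hR]
    have hlower : (if i = 0 then 0 else F (ξ i / a i)) ≤ F ((i + t i * R) / a i) := by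
      split_ifs with h
      · exact F_nonneg _
      · refine F_mono (div_le_div_of_nonneg_right ?_ hai.le)
        rw [hξ i (by omega) hin]
        linarith [mul_le_mul_of_nonneg_right (hst i) hR]
    have h := mul_le_mul_of_nonneg_left
      (neg_log_le_of_F_sub_F_le hai hM (sub_le_sub hupper hlower)) hw
    rw [mul_neg] at h
    refine h.trans_eq ?_
    rw [← sq_abs (t i)]
    field_simp
    ring
  have hquad : ∀ i ∈ Finset.Icc 1 n, d i * ξ i ^ 2 / 4 =
      d i * s i ^ 2 * (R ^ 2 / 4) + d i * i * s i / 2 * R + d i * i ^ 2 / 4 := by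
    intro i hi
    rw [hξ i (Finset.mem_Icc.1 hi).1 (Finset.mem_Icc.1 hi).2]
    ring
  have hsum := Finset.sum_le_sum hlog
  rw [E, Finset.sum_congr rfl hquad, ← Finset.sum_neg_distrib]
  simp only [Finset.sum_add_distrib, ← Finset.sum_mul] at hsum ⊢
  linarith

/-- If the leading coefficient along the ray `ξ_i = i + s_i R` is negative, then `E` is unbounded
below on `Ω` and its sub-level sets are unbounded. -/
theorem unbounded_of_ray (n : ℕ) (u a k d s t : ℕ → ℝ)
    (hu : ∀ i ≤ n, u i < u (i + 1)) (ha : ∀ i ≤ n, 0 < a i) (hk : ∀ i ≤ n, 0 < k i)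
    (hst : ∀ i, s i ≤ t i) (hts : ∀ i, t i ≤ s (i + 1))
    {r : ℕ} (hr1 : 1 ≤ r) (hrn : r ≤ n) (hsr : s r ≠ 0)
    (hneg : ∑ i ∈ Finset.range (n + 1), k i / a i ^ 2 * (u (i + 1) - u i) * t i ^ 2 +
        ∑ i ∈ Finset.Icc 1 n, d i * s i ^ 2 < 0) :
    ¬ BddBelow ((fun x : EuclideanSpace ℝ (Fin n) => E n u a k d (toSeq n x)) ''
        {x | ∀ i j : Fin n, i < j → x i < x j}) ∧
    ∀ c : ℝ, ¬ Bornology.IsBounded {x : EuclideanSpace ℝ (Fin n) |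
      (∀ i j : Fin n, i < j → x i < x j) ∧ E n u a k d (toSeq n x) ≤ c} := by
  obtain ⟨b, c, hE⟩ := exists_E_ray_le n u a k d s t hu ha hk hst hts
  set Q := ∑ i ∈ Finset.range (n + 1), k i / a i ^ 2 * (u (i + 1) - u i) * t i ^ 2 +
    ∑ i ∈ Finset.Icc 1 n, d i * s i ^ 2
  have hs : Monotone s := monotone_nat_of_le_succ fun i => (hst i).trans (hts i)
  let x (R : ℝ) : EuclideanSpace ℝ (Fin n) :=
    WithLp.toLp 2 fun j => ((j + 1 : ℕ) : ℝ) + s (j + 1) * R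
  have hx (R : ℝ) (hR : 0 ≤ R) (i j : Fin n) (hij : i < j) : x R i < x R j := by
    have hij' : (i : ℕ) < j := hij
    have h1 : ((i + 1 : ℕ) : ℝ) < ((j + 1 : ℕ) : ℝ) := by exact_mod_cast Nat.succ_lt_succ hij'
    exact add_lt_add_of_lt_of_le h1
      (mul_le_mul_of_nonneg_right (hs (Nat.succ_le_succ hij'.le)) hR)
  have hEx (R : ℝ) (hR : 0 ≤ R) :
      E n u a k d (toSeq n (x R)) ≤ Q * (R ^ 2 / 4) + b * R + c := by
    refine hE R hR _ fun i hi hin => ?_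
    have h : i - 1 < n := by omega
    simp only [toSeq, dif_pos h, x, Nat.sub_add_cancel hi]
  have hlim : Tendsto (fun R : ℝ => Q * (R ^ 2 / 4) + b * R + c) atTop atBot := by
    have h1 : Tendsto (fun R : ℝ => Q / 4 * R + b) atTop atBot :=
      tendsto_atBot_add_const_right _ _
        (tendsto_id.const_mul_atTop_of_neg (div_neg_of_neg_of_pos hneg (by norm_num)))
    refine (tendsto_atBot_add_const_right _ c (h1.atBot_mul_atTop₀ tendsto_id)).congr fun R => ?_
    simp only [id]
    ring
  constructor
  · rintro ⟨m, hm⟩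
    obtain ⟨R, hR, hRm⟩ := ((eventually_ge_atTop 0).and (hlim.eventually_lt_atBot m)).exists
    exact absurd (hm ⟨x R, hx R hR, rfl⟩) (not_le.2 ((hEx R hR).trans_lt hRm))
  · intro e hb
    obtain ⟨M, hM⟩ := hb.exists_norm_le
    have hnorm : Tendsto (fun R : ℝ => |s r| * R) atTop atTop :=
      tendsto_id.const_mul_atTop (abs_pos.2 hsr)
    obtain ⟨R, hR, hRe, hRM⟩ := ((eventually_ge_atTop 0).and
      ((hlim.eventually_le_atBot e).and (hnorm.eventually_gt_atTop (M + r)))).exists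
    have h1 := hM _ ⟨hx R hR, (hEx R hR).trans hRe⟩
    have h2 := PiLp.norm_apply_le (x R) ⟨r - 1, by omega⟩
    simp only [x, Nat.sub_add_cancel hr1, Real.norm_eq_abs] at h2
    have h3 := abs_sub_abs_le_abs_sub (s r * R) (-(r : ℝ))
    rw [abs_neg, Nat.abs_cast, abs_mul, abs_of_nonneg hR, sub_neg_eq_add, add_comm (s r * R)] at h3
    linarith

/-- If `S^r < 0` for some `1 ≤ r ≤ n` or `S_r < 0` for some `1 ≤ r ≤ n`, then `E` is unbounded
below on `Ω`; in particular every sub-level set `Ω_c` is unbounded. -/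
theorem stmt4 (n : ℕ) (hn : 1 ≤ n) (u a k d : ℕ → ℝ)
    (hu : ∀ i ≤ n, u i < u (i + 1))
    (ha : ∀ i ≤ n, 0 < a i)
    (hk : ∀ i ≤ n, 0 < k i)
    (hneg : (∃ r, 1 ≤ r ∧ r ≤ n ∧
        ∑ i ∈ Finset.Icc 1 r, (k (i - 1) / a (i - 1) ^ 2 * (u i - u (i - 1)) + d i) < 0) ∨
      (∃ r, 1 ≤ r ∧ r ≤ n ∧
        ∑ i ∈ Finset.Icc r n, (k i / a i ^ 2 * (u (i + 1) - u i) + d i) < 0)) :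
    ¬ BddBelow ((fun x : EuclideanSpace ℝ (Fin n) => E n u a k d (toSeq n x)) ''
        {x | ∀ i j : Fin n, i < j → x i < x j}) ∧
    ∀ c : ℝ, ¬ Bornology.IsBounded {x : EuclideanSpace ℝ (Fin n) |
      (∀ i j : Fin n, i < j → x i < x j) ∧ E n u a k d (toSeq n x) ≤ c} := by
  rcases hneg with ⟨r, hr1, hrn, hneg⟩ | ⟨r, hr1, hrn, hneg⟩
  · refine unbounded_of_ray n u a k d (fun i => if i ≤ r then -1 else 0)
      (fun i => if i < r then -1 else 0) hu ha hk ?_ ?_ hr1 hrn (by simp) ?_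
    · intro i
      split_ifs <;> first | omega | norm_num
    · intro i
      split_ifs <;> first | omega | norm_num
    · refine lt_of_eq_of_lt ?_ hneg
      rw [Finset.sum_add_distrib]
      congr 1
      · rw [Finset.sum_congr rfl fun i _ => show _ = if i < r then
          k i / a i ^ 2 * (u (i + 1) - u i) else 0 by split_ifs <;> simp, ← Finset.sum_filter]
        refine Finset.sum_bij (fun i _ => i + 1) ?_ ?_ ?_ ?_
        · intro i hi
          simp only [Finset.mem_filter, Finset.mem_range, Finset.mem_Icc] at hi ⊢
          omega
        · intro i _ j _ hij
          omega
        · intro j hj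
          refine ⟨j - 1, ?_, ?_⟩ <;>
            simp only [Finset.mem_filter, Finset.mem_range, Finset.mem_Icc] at hj ⊢ <;> omega
        · intro i _
          simp
      · rw [Finset.sum_congr rfl fun i _ => show _ = if i ≤ r then d i else 0 by
          split_ifs <;> simp, ← Finset.sum_filter]
        congr 1
        ext i
        simp only [Finset.mem_filter, Finset.mem_Icc]
        omega
  · refine unbounded_of_ray n u a k d (fun i => if r ≤ i then 1 else 0)
      (fun i => if r ≤ i then 1 else 0) hu ha hk (fun _ => le_rfl) ?_ hr1 hrn (by simp) ?_
    · intro i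
      split_ifs <;> first | omega | norm_num
    · refine lt_of_eq_of_lt ?_ hneg
      rw [Finset.sum_add_distrib]
      congr 1
      · rw [Finset.sum_congr rfl fun i _ => show _ = if r ≤ i then
          k i / a i ^ 2 * (u (i + 1) - u i) else 0 by split_ifs <;> simp, ← Finset.sum_filter]
        congr 1
        ext i
        simp only [Finset.mem_filter, Finset.mem_range, Finset.mem_Icc]
        omega
      · rw [Finset.sum_congr rfl fun i _ => show _ = if r ≤ i then d i else 0 by
          split_ifs <;> simp, ← Finset.sum_filter]
        congr 1
        ext i
        simp only [Finset.mem_filter, Finset.mem_Icc]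
        omega
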